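/- Derivable weakening for STR: if Γ ⊢ M : σ is derivable in STR and x ∉ dom(Γ), then for every type τ (linear or stratified) the judgment Γ, x:τ ⊢ M : σ is derivable in STR. -/

import Mathlib

/-! ## Untyped λ-calculus with named variables -/

inductive Term : Type
  | var : ℕ → Term
  | lam : ℕ → Term → Term
  | app : Term → Term → Term
deriving DecidableEq

namespace Term

/-- Free variables of a term. -/
def fv : Term → Finset ℕ
  | var x => {x}
  | lam x M => M.fv.erase x
  | app M N => M.fv ∪ N.fv

/-- Simultaneous substitution of terms for free variables. -/
def subst (ρ : ℕ → Option Term) : Term → Term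
  | var x => (ρ x).getD (var x)
  | lam x M => lam x (M.subst (fun y => if y = x then none else ρ y))
  | app M N => app (M.subst ρ) (N.subst ρ)

/-- Substitution `M[N/x]`. -/
def subst1 (M : Term) (x : ℕ) (N : Term) : Term :=
  M.subst (fun y => if y = x then some N else none)

/-- Renaming `M[x/x₁,…,x/xₙ]`. -/
def renameAll (M : Term) (xs : List ℕ) (x : ℕ) : Term :=
  M.subst (fun y => if y ∈ xs then some (var x) else none)

/-- Size of a term. -/
def size : Term → ℕ
  | var _ => 1
  | lam _ M => M.size + 1
  | app M N => M.size + N.size + 1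

/-- One step of β-reduction (contextual closure of `(λx.M)N → M[N/x]`). -/
inductive Beta : Term → Term → Prop
  | beta (x : ℕ) (M N : Term) : Beta (app (lam x M) N) (M.subst1 x N)
  | lam (x : ℕ) {M M' : Term} : Beta M M' → Beta (lam x M) (lam x M')
  | appL {M M' : Term} (N : Term) : Beta M M' → Beta (app M N) (app M' N)
  | appR (M : Term) {N N' : Term} : Beta N N' → Beta (app M N) (app M N')

end Term

/-- β-reduction in exactly `m` steps. -/
inductive BetaN : ℕ → Term → Term → Prop
  | refl (M : Term) : BetaN 0 M M
  | step {M N P : Term} {m : ℕ} : Term.Beta M N → BetaN m N P → BetaN (m + 1) M P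

/-- Strong normalization with respect to β-reduction. -/
def StronglyNormalizing (M : Term) : Prop := Acc (fun a b => Term.Beta b a) M

/-! ## STR types: linear and stratified types.
A stratified type `{σ₁,…,σₙ}` (n > 0) is represented as a head `σ₁` together with
the list `[σ₂,…,σₙ]` of the remaining components. -/

mutual
inductive LinTy : Type
  | tvar : ℕ → LinTy
  | arrow : STy → LinTy → LinTy
  | all : ℕ → LinTy → LinTy

inductive STy : Type
  | lin : LinTy → STy
  | strat : STy → List STy → STy
end

mutual
/-- Free type variables of a linear type. -/
def LinTy.ftv : LinTy → Finset ℕ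
  | .tvar a => {a}
  | .arrow σ A => σ.ftv ∪ A.ftv
  | .all a A => A.ftv.erase a

/-- Free type variables of a stratified type. -/
def STy.ftv : STy → Finset ℕ
  | .lin A => A.ftv
  | .strat σ l => σ.ftv ∪ STy.ftvList l

def STy.ftvList : List STy → Finset ℕ
  | [] => ∅
  | σ :: l => σ.ftv ∪ STy.ftvList l
end

mutual
/-- Substitution of the linear type `A` for the type variable `a`. -/
def LinTy.tsubst (a : ℕ) (A : LinTy) : LinTy → LinTy
  | .tvar b => if b = a then A else .tvar b
  | .arrow σ B => .arrow (STy.tsubst a A σ) (LinTy.tsubst a A B)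
  | .all b B => if b = a then .all b B else .all b (LinTy.tsubst a A B)
termination_by B => sizeOf B

def STy.tsubst (a : ℕ) (A : LinTy) : STy → STy
  | .lin B => .lin (LinTy.tsubst a A B)
  | .strat σ l => .strat (STy.tsubst a A σ) (STy.tsubstList a A l)
termination_by σ => sizeOf σ

def STy.tsubstList (a : ℕ) (A : LinTy) : List STy → List STy
  | [] => []
  | σ :: l => STy.tsubst a A σ :: STy.tsubstList a A l
termination_by l => sizeOf l
end

mutual
/-- The (multi)set of linear components of a type, as a list. -/
def STy.linComps : STy → List LinTy
  | .lin A => [A]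
  | .strat σ l => σ.linComps ++ STy.linCompsList l

def STy.linCompsList : List STy → List LinTy
  | [] => []
  | σ :: l => σ.linComps ++ STy.linCompsList l
end

/-! ## Contexts -/

/-- A context is a partial function from term variables to STR types. -/
abbrev Ctx := ℕ → Option STy

namespace Ctx

def dom (Γ : Ctx) : Set ℕ := {x | Γ x ≠ none}

def empty : Ctx := fun _ => none

/-- `Γ, x:σ`. -/
def cons (Γ : Ctx) (x : ℕ) (σ : STy) : Ctx := fun y => if y = x then some σ else Γ y

/-- `Γ, x₁:σ₁, …, xₙ:σₙ`. -/
def consList (Γ : Ctx) (l : List (ℕ × STy)) : Ctx :=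
  l.foldr (fun p Δ => Ctx.cons Δ p.1 p.2) Γ

/-- Concatenation `Γ, Δ` of two contexts (with disjoint domains). -/
def append (Γ Δ : Ctx) : Ctx := fun x => (Γ x).orElse (fun _ => Δ x)

def appendAll (l : List Ctx) : Ctx := l.foldr append empty

/-- `Γ # Δ` : disjointness of domains. -/
def Disj (Γ Δ : Ctx) : Prop := ∀ x, Γ x = none ∨ Δ x = none

/-- The context `∪ᵢ{Γᵢ}` of rule (st): `(∪ᵢ{Γᵢ})(x) = {Γ₀(x), Γ₁(x), …}`. -/
def stratUnion (Γ0 : Ctx) (Γs : List Ctx) : Ctx := fun x =>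
  (Γ0 x).map (fun σ => STy.strat σ (Γs.filterMap (fun Γ => Γ x)))

end Ctx

/-! ## The STR type assignment system.
`Deriv Γ M σ` is the type of STR derivations of `Γ ⊢ M : σ`. -/

inductive Deriv : Ctx → Term → STy → Type
  | ax (x : ℕ) (A : LinTy) :
      Deriv (Ctx.cons Ctx.empty x (.lin A)) (.var x) (.lin A)
  | w {Γ : Ctx} {M : Term} {σ : STy} (x : ℕ) (A : LinTy) (hx : Γ x = none) :
      Deriv Γ M σ → Deriv (Ctx.cons Γ x (.lin A)) M σ
  | lam {Γ : Ctx} {M : Term} (x : ℕ) (σ : STy) (B : LinTy) (hx : Γ x = none) :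
      Deriv (Ctx.cons Γ x σ) M (.lin B) →
      Deriv Γ (.lam x M) (.lin (.arrow σ B))
  | app {Γ1 Γ2 : Ctx} {M N : Term} {σ : STy} {A : LinTy}
      (hdisj : Ctx.Disj Γ1 Γ2) :
      Deriv Γ1 M (.lin (.arrow σ A)) → Deriv Γ2 N σ →
      Deriv (Ctx.append Γ1 Γ2) (.app M N) (.lin A)
  | m {Γ : Ctx} {M : Term} {τ : STy} (x x0 : ℕ) (xs : List ℕ) (σ0 : STy) (σs : List STy)
      (hlen : xs.length = σs.length)
      (hnodup : (x0 :: xs).Nodup)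
      (hfresh : ∀ y ∈ x0 :: xs, Γ y = none)
      (hx : Γ x = none) :
      Deriv (Ctx.consList Γ ((x0 :: xs).zip (σ0 :: σs))) M τ →
      Deriv (Ctx.cons Γ x (.strat σ0 σs)) (M.renameAll (x0 :: xs) x) τ
  | st {M : Term} (Γ0 : Ctx) (σ0 : STy) (k : ℕ) (Γs : Fin k → Ctx) (σs : Fin k → STy)
      (hdom : ∀ i, Ctx.dom (Γs i) = Ctx.dom Γ0)
      (p0 : Deriv Γ0 M σ0) (ps : ∀ i, Deriv (Γs i) M (σs i)) :
      Deriv (Ctx.stratUnion Γ0 (List.ofFn Γs)) M (.strat σ0 (List.ofFn σs))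
  | allI {Γ : Ctx} {M : Term} {A : LinTy} (a : ℕ)
      (ha : ∀ x σ, Γ x = some σ → a ∉ STy.ftv σ) :
      Deriv Γ M (.lin A) → Deriv Γ M (.lin (.all a A))
  | allE {Γ : Ctx} {M : Term} (a : ℕ) (B A : LinTy) :
      Deriv Γ M (.lin (.all a B)) → Deriv Γ M (.lin (B.tsubst a A))

/-- `M` is typable in STR. -/
def Typable (M : Term) : Prop := ∃ (Γ : Ctx) (σ : STy), Nonempty (Deriv Γ M σ)

namespace Term

/-- A substitution that is trivial on the free variables of `M` leaves `M` unchanged. -/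
theorem subst_eq_self (M : Term) (ρ : ℕ → Option Term) (h : ∀ y ∈ M.fv, ρ y = none) :
    M.subst ρ = M := by
  induction M generalizing ρ with
  | var x => simp [subst, h x (by simp [fv])]
  | lam x M ih =>
    rw [subst, ih]
    intro y hy
    by_cases hyx : y = x
    · simp [hyx]
    · simpa [hyx] using h y (by simp [fv, hyx, hy])
  | app M N ihM ihN =>
    rw [subst, ihM ρ fun y hy => h y (by simp [fv, hy]),
      ihN ρ fun y hy => h y (by simp [fv, hy])]

theorem renameAll_eq_self (M : Term) (xs : List ℕ) (x : ℕ) (h : ∀ y ∈ xs, y ∉ M.fv) :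
    M.renameAll xs x = M :=
  subst_eq_self M _ fun y hy => if_neg fun hmem => h y hmem hy

end Term

namespace Ctx

theorem dom_cons (Γ : Ctx) (x : ℕ) (σ : STy) : dom (cons Γ x σ) = insert x (dom Γ) := by
  ext y
  by_cases h : y = x <;> simp [dom, cons, h]

theorem dom_consList (Γ : Ctx) (l : List (ℕ × STy)) :
    dom (consList Γ l) = {y | y ∈ l.map Prod.fst} ∪ dom Γ := by
  induction l with
  | nil => simp [consList]
  | cons p l ih =>
    change dom (cons (consList Γ l) p.1 p.2) = _
    rw [dom_cons, ih]
    ext y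
    simp [or_assoc]

theorem dom_append (Γ Δ : Ctx) : dom (append Γ Δ) = dom Γ ∪ dom Δ := by
  ext y
  cases h : Γ y <;> simp [dom, append, h]

theorem dom_stratUnion (Γ : Ctx) (Γs : List Ctx) : dom (stratUnion Γ Γs) = dom Γ := by
  ext y
  simp [dom, stratUnion]

end Ctx

theorem Deriv.finite_dom {Γ : Ctx} {M : Term} {σ : STy} (d : Deriv Γ M σ) :
    (Ctx.dom Γ).Finite := by
  induction d with
  | ax x A => rw [Ctx.dom_cons]; simp [Ctx.dom, Ctx.empty]
  | w x A hx d ih => rw [Ctx.dom_cons]; exact ih.insert x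
  | lam x σ B hx d ih => rw [Ctx.dom_cons] at ih; exact ih.subset (Set.subset_insert _ _)
  | app hdisj d₁ d₂ ih₁ ih₂ => rw [Ctx.dom_append]; exact ih₁.union ih₂
  | m x x0 xs σ0 σs hlen hnodup hfresh hx d ih =>
    rw [Ctx.dom_consList] at ih
    rw [Ctx.dom_cons]
    exact (ih.subset Set.subset_union_right).insert x
  | st Γ0 σ0 k Γs σs hdom p0 ps ih0 ihs => rwa [Ctx.dom_stratUnion]
  | allI a ha d ih => exact ih
  | allE a B A d ih => exact ih

/-- Weakening by a type `τ` is derivable. -/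
def STy.Weakens (τ : STy) : Prop :=
  ∀ (Γ : Ctx) (M : Term) (σ : STy) (x : ℕ), Nonempty (Deriv Γ M σ) → Γ x = none →
    Nonempty (Deriv (Ctx.cons Γ x τ) M σ)

theorem Deriv.weaken_list {Γ : Ctx} {M : Term} {σ : STy} (h : Nonempty (Deriv Γ M σ))
    (l : List (ℕ × STy)) (hnodup : (l.map Prod.fst).Nodup)
    (hfresh : ∀ y ∈ l.map Prod.fst, Γ y = none) (hl : ∀ p ∈ l, p.2.Weakens) :
    Nonempty (Deriv (Ctx.consList Γ l) M σ) := by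
  induction l with
  | nil => exact h
  | cons p l ih =>
    rw [List.map_cons, List.nodup_cons] at hnodup
    have hd := ih hnodup.2 (fun y hy => hfresh y (List.mem_cons_of_mem _ hy))
      fun q hq => hl q (List.mem_cons_of_mem _ hq)
    refine hl p List.mem_cons_self _ M σ p.1 hd ?_
    by_contra hne
    have hmem : p.1 ∈ Ctx.dom (Ctx.consList Γ l) := hne
    rw [Ctx.dom_consList] at hmem
    exact hmem.elim hnodup.1 fun hdom => hdom (hfresh p.1 List.mem_cons_self)

/-- Weakening by a stratified type reduces to weakening by its components: weaken with fresh
variables and contract them by rule (m), which does not affect the term. -/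
theorem STy.Weakens.strat {σ₀ : STy} {σs : List STy} (h : ∀ ρ ∈ σ₀ :: σs, ρ.Weakens) :
    (STy.strat σ₀ σs).Weakens := by
  rintro Γ M σ x ⟨d⟩ hx
  obtain ⟨t, hts, htc⟩ := (d.finite_dom.union M.fv.finite_toSet).infinite_compl
    |>.exists_subset_card_eq (σs.length + 1)
  obtain ⟨x₀, xs, hxs⟩ := List.exists_cons_of_length_eq_add_one
    ((Finset.length_toList t).trans htc)
  have hlen : xs.length = σs.length := by
    have := (Finset.length_toList t).trans htc
    simpa [hxs] using this
  have hnodup : (x₀ :: xs).Nodup := hxs ▸ t.nodup_toList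
  have havoid : ∀ y ∈ x₀ :: xs, Γ y = none ∧ y ∉ M.fv := by
    intro y hy
    have := hts (Finset.mem_coe.2 (Finset.mem_toList.1 (hxs ▸ hy)))
    simpa [Ctx.dom] using this
  have hmap : ((x₀ :: xs).zip (σ₀ :: σs)).map Prod.fst = x₀ :: xs :=
    List.map_fst_zip (by simp [hlen])
  obtain ⟨e⟩ := Deriv.weaken_list ⟨d⟩ ((x₀ :: xs).zip (σ₀ :: σs)) (by rwa [hmap])
    (by rw [hmap]; exact fun y hy => (havoid y hy).1)
    fun p hp => h p.2 (List.of_mem_zip hp).2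
  have e' := Deriv.m x x₀ xs σ₀ σs hlen hnodup (fun y hy => (havoid y hy).1) hx e
  rw [Term.renameAll_eq_self M _ x fun y hy => (havoid y hy).2] at e'
  exact ⟨e'⟩

theorem STy.weakens : ∀ τ : STy, τ.Weakens
  | .lin A => fun _ _ _ x ⟨d⟩ hx => ⟨d.w x A hx⟩
  | .strat σ₀ σs => .strat fun ρ hρ => by
      have : sizeOf ρ < sizeOf (STy.strat σ₀ σs) := by
        have := List.sizeOf_lt_of_mem hρ
        simpa [Nat.add_assoc] using this
      exact STy.weakens ρ
termination_by τ => sizeOf τ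

/-- **Derivable weakening for STR**: if `Γ ⊢ M : σ` is derivable in STR and `x ∉ dom(Γ)`,
then for every type `τ` (linear or stratified) `Γ, x:τ ⊢ M : σ` is derivable in STR. -/
theorem str_weakening (Γ : Ctx) (M : Term) (σ : STy) (x : ℕ)
    (h : Nonempty (Deriv Γ M σ)) (hx : Γ x = none) (τ : STy) :
    Nonempty (Deriv (Ctx.cons Γ x τ) M σ) :=
  τ.weakens Γ M σ x h hx
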